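/- Let q > 0 with q ≠ 1, and assume ∑_j α_j + ∑_i β_i = 1. Then for 1 ≤ m ≤ n, ⟨R^{left}_{m−1} ∘ ⋯ ∘ R^{left}_1 Ξ, Ξ⟩ = (q−1)^{−1} ∑_{μ} ( ∏_{k≥1} (q^k − 1)^{μ_k} / (k^{μ_k} · μ_k!) ) · ( ∏_{k≥2} p_k(α,β)^{μ_k} ), where the sum is over all finitely supported functions μ : {1,2,3,…} → ℕ with ∑_k k·μ_k = m. In other words, the matrix element of the Iwahori–Hecke element ζ_m = σ_{m−1}⋯σ_2σ_1 in the tensor model equals the value χ^{α,β,0}(ζ_m) of the Vershik–Kerov indecomposable trace with parameters (α, β, γ = 0). -/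

import Mathlib

noncomputable section

/-- The set of nonzero integers. -/
abbrev Sz : Type := {i : ℤ // i ≠ 0}

/-- The Hilbert space `ℓ²(S^n × S^n; ℂ)`. -/
abbrev HVW (n : ℕ) : Type := lp (fun _ : (Fin n → Sz) × (Fin n → Sz) => ℂ) 2

/-- Canonical orthonormal basis vectors `e_{I,J}`. -/
def eVW {n : ℕ} (I J : Fin n → Sz) : HVW n := lp.single 2 (I, J) (1 : ℂ)

/-- The unit vector `Ξ = ∑_I (∏_k a(I_k))^{1/2} e_{I,I}`. -/
def Xi (n : ℕ) (a : Sz → ℝ) : HVW n :=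
  ∑' I : Fin n → Sz, (Real.sqrt (∏ k, a (I k)) : ℂ) • eVW I I

/-- The tuple `I` with its entries at positions `p` and `p'` interchanged. -/
def swapAt {n : ℕ} (I : Fin n → Sz) (p p' : Fin n) : Fin n → Sz :=
  Function.update (Function.update I p (I p')) p' (I p)

/-- The diagonal coefficient `c_q(i,j)`: `−1` if `i = j < 0`, `q` if `i = j > 0`,
`q − 1` if `i < j`, and `0` if `i > j`. -/
def cq (q : ℝ) (i j : Sz) : ℝ :=
  if (i : ℤ) = (j : ℤ) then (if (i : ℤ) < 0 then -1 else q)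
  else if (i : ℤ) < (j : ℤ) then q - 1 else 0

/-- `R` acts on basis vectors `e_{I,J}` by the Kerov R-matrix rules applied to the pair
`(I_k, I_{k+1})` (0-based positions `k`, `k+1`), leaving the other entries of `I` and all
of `J` unchanged. -/
def KerovRuleVW (n : ℕ) (q : ℝ) (k : ℕ) (hk : k + 1 < n)
    (R : HVW n →L[ℂ] HVW n) : Prop :=
  ∀ I J : Fin n → Sz,
    ((I ⟨k, Nat.lt_of_succ_lt hk⟩ : ℤ) = (I ⟨k + 1, hk⟩ : ℤ) →
      (((I ⟨k, Nat.lt_of_succ_lt hk⟩ : ℤ) < 0 → R (eVW I J) = - eVW I J) ∧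
       (0 < (I ⟨k, Nat.lt_of_succ_lt hk⟩ : ℤ) → R (eVW I J) = (q : ℂ) • eVW I J))) ∧
    ((I ⟨k + 1, hk⟩ : ℤ) < (I ⟨k, Nat.lt_of_succ_lt hk⟩ : ℤ) →
      R (eVW I J) = -((Real.sqrt q : ℂ) •
        eVW (swapAt I ⟨k, Nat.lt_of_succ_lt hk⟩ ⟨k + 1, hk⟩) J)) ∧
    ((I ⟨k, Nat.lt_of_succ_lt hk⟩ : ℤ) < (I ⟨k + 1, hk⟩ : ℤ) →
      R (eVW I J) = -((Real.sqrt q : ℂ) •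
        eVW (swapAt I ⟨k, Nat.lt_of_succ_lt hk⟩ ⟨k + 1, hk⟩) J) + ((q : ℂ) - 1) • eVW I J)

/-- `opChain F j = F (j-1) ∘ ⋯ ∘ F 1 ∘ F 0` (and the identity for `j = 0`). -/
def opChain {n : ℕ} (F : ℕ → (HVW n →L[ℂ] HVW n)) : ℕ → (HVW n →L[ℂ] HVW n)
  | 0 => 1
  | j + 1 => F j * opChain F j

/-- The weights `a : S → ℝ`: `a(j) = α_j` for `j > 0` and `a(−i) = β_i` for `i > 0`
(with `α`, `β` indexed by `ℕ`, index `j` standing for the paper's `j+1`). -/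
def aOf (α β : ℕ → ℝ) (i : Sz) : ℝ :=
  if 0 < (i : ℤ) then α ((i : ℤ).toNat - 1) else β ((-(i : ℤ)).toNat - 1)

/-- The super-Newton sum `p_k(α,β) = ∑_j α_j^k + (−1)^{k−1} ∑_i β_i^k`. -/
def superNewton (α β : ℕ → ℝ) (k : ℕ) : ℝ :=
  (∑' j, α j ^ k) + (-1 : ℝ) ^ (k - 1) * ∑' i, β i ^ k

/-!
STATEMENT 18: For `q > 0`, `q ≠ 1` and `1 ≤ m ≤ n`, the matrix element of the Iwahori–Hecke
element `ζ_m = σ_{m−1}⋯σ_1` in the tensor model equals the Vershik–Kerov indecomposable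
trace value `χ^{α,β,0}(ζ_m)`:
`⟨R^{left}_{m−1} ∘ ⋯ ∘ R^{left}_1 Ξ, Ξ⟩ = (q−1)⁻¹ ∑_μ (∏_{k≥1} (q^k−1)^{μ_k}/(k^{μ_k} μ_k!))
 (∏_{k≥2} p_k(α,β)^{μ_k})`,
the sum being over finitely supported `μ : {1,2,…} → ℕ` with `∑_k k·μ_k = m`.
(A finitely supported `μ` is rendered as `μ : ℕ →₀ ℕ` with index `j` standing for the
paper's `k = j+1`; the operators `Rl k` act on the 0-based positions `k, k+1`, so the
chain `R_{m−1}⋯R_1` is `opChain Rl (m−1)`, the identity when `m = 1`.  Mathlib's inner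
product is conjugate-linear in the first variable, so the paper's `⟨A Ξ, Ξ⟩` is rendered
as `inner Ξ (A Ξ)`.)
-/

theorem PowerSeries.mk_pow_succ_mul_one_sub (u : ℝ) :
    PowerSeries.mk (fun j => u ^ (j + 1)) * (1 - PowerSeries.C u * PowerSeries.X)
      = PowerSeries.C u := by
  ext n
  rw [mul_sub, mul_one, map_sub, mul_left_comm, PowerSeries.coeff_C_mul]
  cases n with
  | zero => simp
  | succ n =>
    rw [PowerSeries.coeff_succ_mul_X]
    simp
    ring

/-- Multiplying by `(1 - vX) / (1 - uX)` changes the logarithmic derivative by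
`∑ (u^(j+1) - v^(j+1)) X^j`. -/
theorem PowerSeries.derivative_eq_of_mul_one_sub_eq {E F Q : PowerSeries ℝ} {u v : ℝ}
    (hE : PowerSeries.derivative ℝ E = Q * E)
    (h : F * (1 - PowerSeries.C u * PowerSeries.X) = E * (1 - PowerSeries.C v * PowerSeries.X)) :
    PowerSeries.derivative ℝ F
      = (Q + PowerSeries.mk (fun j => u ^ (j + 1) - v ^ (j + 1))) * F := by
  have hU := PowerSeries.mk_pow_succ_mul_one_sub u
  have hV := PowerSeries.mk_pow_succ_mul_one_sub v
  have hUV : PowerSeries.mk (fun j => u ^ (j + 1) - v ^ (j + 1))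
      = PowerSeries.mk (fun j => u ^ (j + 1)) - PowerSeries.mk (fun j => v ^ (j + 1)) := by
    ext; simp
  have hne : (1 - PowerSeries.C u * PowerSeries.X : PowerSeries ℝ) ≠ 0 := by
    intro h0
    simpa using congrArg PowerSeries.constantCoeff h0
  have hd := congrArg (PowerSeries.derivative ℝ) h
  simp only [Derivation.leibniz, map_sub, Derivation.map_one_eq_zero, smul_eq_mul,
    PowerSeries.derivative_C, PowerSeries.derivative_X, hE, mul_zero, mul_one, zero_sub,
    add_zero] at hd
  apply mul_right_cancel₀ hne
  rw [hUV]
  linear_combination hd - F * hU + E * hV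
    + (PowerSeries.mk (fun j => v ^ (j + 1)) - Q) * h

/-- The total weight of the words of length `m + 1` with all letters but the last in `T` and
with last letter `y`. -/
def lastLetterWeight (q : ℝ) (a : Sz → ℝ) (T : Finset Sz) : ℕ → Sz → ℝ
  | 0, y => a y
  | m + 1, y => a y * ∑ x ∈ T, lastLetterWeight q a T m x * cq q x y

theorem lastLetterWeight_insert (q : ℝ) (a : Sz → ℝ) (T : Finset Sz) (x : Sz)
    (hx : ∀ z ∈ T, z < x) (m : ℕ) {y : Sz} (hy : y ∈ T) :
    lastLetterWeight q a (insert x T) m y = lastLetterWeight q a T m y := by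
  induction m generalizing y with
  | zero => rfl
  | succ m ih =>
    have hxT : x ∉ T := fun h => lt_irrefl _ (hx x h)
    have hyx : (y : ℤ) < x := hx y hy
    have hc : cq q x y = 0 := by
      simp only [cq, hyx.ne', hyx.not_gt, if_false]
    rw [lastLetterWeight, lastLetterWeight, Finset.sum_insert hxT, hc, mul_zero, zero_add]
    congr 1
    exact Finset.sum_congr rfl fun z hz => by rw [ih hz]

/-- The generating series of the total weights of words over `T`, normalized to have
constant term `1`. -/
def wordSeries (q : ℝ) (a : Sz → ℝ) (T : Finset Sz) : PowerSeries ℝ :=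
  1 + PowerSeries.C (q - 1) * PowerSeries.X *
    ∑ x ∈ T, PowerSeries.mk (fun m => lastLetterWeight q a T m x)

theorem wordSeries_insert (q : ℝ) (a : Sz → ℝ) (T : Finset Sz) (x : Sz)
    (hx : ∀ z ∈ T, z < x) :
    wordSeries q a (insert x T) * (1 - PowerSeries.C (cq q x x * a x) * PowerSeries.X)
      = wordSeries q a T *
        (1 - PowerSeries.C (cq q x x * a x - (q - 1) * a x) * PowerSeries.X) := by
  have hxT : x ∉ T := fun h => lt_irrefl _ (hx x h)
  set B := PowerSeries.mk (fun m => lastLetterWeight q a (insert x T) m x) with hB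
  have hsum : wordSeries q a (insert x T)
      = wordSeries q a T + PowerSeries.C (q - 1) * PowerSeries.X * B := by
    have : ∀ z ∈ T, PowerSeries.mk (fun m => lastLetterWeight q a (insert x T) m z)
        = PowerSeries.mk (fun m => lastLetterWeight q a T m z) := fun z hz => by
      ext m; simp [lastLetterWeight_insert q a T x hx m hz]
    rw [wordSeries, wordSeries, Finset.sum_insert hxT, Finset.sum_congr rfl this]
    ring
  have hrec : B = PowerSeries.C (a x) *
      (wordSeries q a T + PowerSeries.X * (PowerSeries.C (cq q x x) * B)) := by
    ext m
    cases m with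
    | zero => simp [hB, wordSeries, lastLetterWeight]
    | succ m =>
      have hc : ∀ z ∈ T, lastLetterWeight q a (insert x T) m z * cq q z x
          = (q - 1) * lastLetterWeight q a T m z := fun z hz => by
        have hzx : (z : ℤ) < x := hx z hz
        rw [lastLetterWeight_insert q a T x hx m hz]
        simp [cq, hzx.ne, hzx, mul_comm]
      rw [PowerSeries.coeff_C_mul, map_add, PowerSeries.coeff_succ_X_mul, wordSeries, map_add,
        mul_assoc, PowerSeries.coeff_C_mul, PowerSeries.coeff_succ_X_mul, map_sum,
        PowerSeries.coeff_C_mul]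
      simp only [hB, PowerSeries.coeff_mk, lastLetterWeight, Finset.sum_insert hxT,
        Finset.sum_congr rfl hc, ← Finset.mul_sum, PowerSeries.coeff_one]
      rw [if_neg (Nat.succ_ne_zero m)]
      ring
  rw [hsum]
  simp only [map_sub, map_mul] at *
  linear_combination (PowerSeries.C q - PowerSeries.C 1) * PowerSeries.X * hrec

/-- The summand `(±1)^j a(x)^(j+1)` of the super-Newton sum. -/
def superTerm (a : Sz → ℝ) (j : ℕ) (x : Sz) : ℝ :=
  (if 0 < (x : ℤ) then 1 else (-1) ^ j) * a x ^ (j + 1)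

theorem derivative_wordSeries (q : ℝ) (a : Sz → ℝ) (T : Finset Sz) :
    PowerSeries.derivative ℝ (wordSeries q a T)
      = PowerSeries.mk (fun j => (q ^ (j + 1) - 1) * ∑ x ∈ T, superTerm a j x)
        * wordSeries q a T := by
  induction T using Finset.induction_on_max with
  | empty =>
    ext n; simp [wordSeries]
  | insert x T hx ih =>
    have hxT : x ∉ T := fun h => lt_irrefl _ (hx x h)
    rw [PowerSeries.derivative_eq_of_mul_one_sub_eq ih (wordSeries_insert q a T x hx)]
    congr 1
    ext j
    simp only [map_add, PowerSeries.coeff_mk, Finset.sum_insert hxT, superTerm]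
    rcases lt_or_gt_of_ne x.2 with h | h
    · simp only [cq, h, h.not_gt, if_true, if_false]
      rw [show (-1 * a x - (q - 1) * a x) = -1 * (q * a x) by ring, mul_pow, mul_pow, mul_pow]
      ring
    · simp only [cq, h, h.not_gt, if_true, if_false]
      rw [show (q * a x - (q - 1) * a x) = a x by ring, mul_pow]
      ring

theorem finite_setOf_finsupp_sum_eq (m : ℕ) :
    {μ : ℕ →₀ ℕ | μ.sum (fun j t => (j + 1) * t) = m}.Finite := by
  have hle : ∀ μ : ℕ →₀ ℕ, μ.sum (fun j t => (j + 1) * t) = m →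
      ∀ j ∈ μ.support, (j + 1) * μ j ≤ m := fun μ hμ j hj => by
    rw [← hμ]
    exact Finset.single_le_sum (f := fun j => (j + 1) * μ j) (fun _ _ => Nat.zero_le _) hj
  refine (Set.finite_Iic
    (Finsupp.onFinset (Finset.range m) (fun j => if j < m then m else 0) ?_)).subset ?_
  · intro j hj
    simpa using (ite_ne_right_iff.1 hj).1
  · intro μ hμ j
    rw [Finsupp.onFinset_apply]
    by_cases hj : μ j = 0
    · simp [hj]
    · have h := hle μ hμ j (Finsupp.mem_support_iff.2 hj)
      have hpos : 0 < μ j := Nat.pos_of_ne_zero hj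
      rw [if_pos (by nlinarith)]
      nlinarith

/-- The multiplicity functions of the partitions of `m`. -/
def multiplicities (m : ℕ) : Finset (ℕ →₀ ℕ) :=
  (finite_setOf_finsupp_sum_eq m).toFinset

theorem mem_multiplicities {m : ℕ} {μ : ℕ →₀ ℕ} :
    μ ∈ multiplicities m ↔ μ.sum (fun j t => (j + 1) * t) = m := by
  simp [multiplicities]

/-- The term indexed by `μ` in the expansion of `exp (∑ j, t j X^(j+1) / (j+1))`. -/
def cycleTerm (t : ℕ → ℝ) (μ : ℕ →₀ ℕ) : ℝ :=
  μ.prod fun j k => t j ^ k / ((j + 1 : ℝ) ^ k * (Nat.factorial k))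

theorem cycleTerm_add_single (t : ℕ → ℝ) (ν : ℕ →₀ ℕ) (i : ℕ) :
    ((i + 1) * ((ν + Finsupp.single i 1 : ℕ →₀ ℕ) i : ℕ) : ℝ) * cycleTerm t (ν + Finsupp.single i 1)
      = t i * cycleTerm t ν := by
  have herase : (ν + Finsupp.single i 1).erase i = ν.erase i := by
    ext j
    by_cases h : j = i <;> simp [h]
  rw [cycleTerm, cycleTerm, ← Finsupp.mul_prod_erase' (ν + Finsupp.single i 1) i _ (by simp),
    ← Finsupp.mul_prod_erase' ν i _ (by simp), herase]
  simp only [Finsupp.add_apply, Finsupp.single_eq_same, Nat.factorial_succ, pow_succ]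
  push_cast
  have h1 : (i + 1 : ℝ) ≠ 0 := by positivity
  have h2 : (ν i + 1 : ℝ) ≠ 0 := by positivity
  have h3 : ((ν i).factorial : ℝ) ≠ 0 := by positivity
  field_simp

theorem sum_add_single (ν : ℕ →₀ ℕ) (i : ℕ) :
    (ν + Finsupp.single i 1).sum (fun j t => (j + 1) * t)
      = ν.sum (fun j t => (j + 1) * t) + (i + 1) := by
  rw [Finsupp.sum_add_index' (by simp) (by intros; ring), Finsupp.sum_single_index (by simp),
    mul_one]

theorem succ_mul_sum_cycleTerm (t : ℕ → ℝ) (m : ℕ) :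
    (m + 1 : ℝ) * ∑ μ ∈ multiplicities (m + 1), cycleTerm t μ
      = ∑ p ∈ Finset.HasAntidiagonal.antidiagonal m, t p.1 * ∑ ν ∈ multiplicities p.2, cycleTerm t ν := by
  have hL : (m + 1 : ℝ) * ∑ μ ∈ multiplicities (m + 1), cycleTerm t μ
      = ∑ x ∈ (multiplicities (m + 1)).sigma (fun μ => μ.support),
          ((x.2 + 1) * x.1 x.2 : ℝ) * cycleTerm t x.1 := by
    rw [Finset.sum_sigma, Finset.mul_sum]
    refine Finset.sum_congr rfl fun μ hμ => ?_
    have h := mem_multiplicities.1 hμ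
    dsimp only
    rw [← Finset.sum_mul]
    congr 1
    rw [Finsupp.sum] at h
    exact_mod_cast h.symm
  have hR : ∑ p ∈ Finset.HasAntidiagonal.antidiagonal m, t p.1 * ∑ ν ∈ multiplicities p.2, cycleTerm t ν
      = ∑ y ∈ (Finset.HasAntidiagonal.antidiagonal m).sigma (fun p => multiplicities p.2),
          t y.1.1 * cycleTerm t y.2 := by
    rw [Finset.sum_sigma]
    exact Finset.sum_congr rfl fun p _ => Finset.mul_sum _ _ _
  have hback : ∀ (μ : ℕ →₀ ℕ) (i : ℕ), i ∈ μ.support →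
      μ - Finsupp.single i 1 + Finsupp.single i 1 = μ := fun μ i hi =>
    tsub_add_cancel_of_le
      (Finsupp.single_le_iff.2 (Nat.pos_of_ne_zero (Finsupp.mem_support_iff.1 hi)))
  rw [hL, hR]
  symm
  refine Finset.sum_bij' (fun y _ => ⟨y.2 + Finsupp.single y.1.1 1, y.1.1⟩)
    (fun x _ => ⟨(x.2, m - x.2), x.1 - Finsupp.single x.2 1⟩) ?_ ?_ ?_ ?_ ?_
  · rintro ⟨⟨i, j⟩, ν⟩ h
    simp only [Finset.mem_sigma, Finset.HasAntidiagonal.mem_antidiagonal, mem_multiplicities] at h ⊢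
    refine ⟨by rw [sum_add_single]; omega, by simp⟩
  · rintro ⟨μ, i⟩ h
    simp only [Finset.mem_sigma, Finset.HasAntidiagonal.mem_antidiagonal, mem_multiplicities] at h ⊢
    have h1 := sum_add_single (μ - Finsupp.single i 1) i
    rw [hback μ i h.2, h.1] at h1
    omega
  · rintro ⟨⟨i, j⟩, ν⟩ h
    simp only [Finset.mem_sigma, Finset.HasAntidiagonal.mem_antidiagonal] at h ⊢
    have hj : m - i = j := by omega
    simp [hj]
  · rintro ⟨μ, i⟩ h
    simp only [Finset.mem_sigma] at h ⊢
    simp only [hback μ i h.2]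
  · rintro ⟨⟨i, j⟩, ν⟩ h
    exact (cycleTerm_add_single t ν i).symm

theorem coeff_eq_sum_cycleTerm {E : PowerSeries ℝ} {t : ℕ → ℝ}
    (h0 : PowerSeries.coeff 0 E = 1)
    (hE : PowerSeries.derivative ℝ E = PowerSeries.mk t * E) (m : ℕ) :
    PowerSeries.coeff m E = ∑ μ ∈ multiplicities m, cycleTerm t μ := by
  induction m using Nat.strong_induction_on with
  | _ m ih =>
    cases m with
    | zero =>
      have : multiplicities 0 = {0} := by
        ext μ
        rw [mem_multiplicities, Finset.mem_singleton, Finsupp.sum, Finset.sum_eq_zero_iff]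
        constructor
        · intro h
          ext j
          by_contra hj
          exact hj (by simpa using h j (Finsupp.mem_support_iff.2 hj))
        · rintro rfl
          simp
      simp [this, h0, cycleTerm]
    | succ m =>
      have hm : (m + 1 : ℝ) ≠ 0 := by positivity
      apply mul_left_cancel₀ hm
      rw [succ_mul_sum_cycleTerm, mul_comm, ← PowerSeries.coeff_derivative, hE,
        PowerSeries.coeff_mul]
      refine Finset.sum_congr rfl fun p hp => ?_
      rw [PowerSeries.coeff_mk, ih p.2 (by have := Finset.HasAntidiagonal.mem_antidiagonal.1 hp; omega)]

/-- The product of the diagonal coefficients along the first `j + 1` letters of `I`. -/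
def chainWeight (q : ℝ) {n : ℕ} (I : Fin n → Sz) (j : ℕ) : ℝ :=
  ∏ k ∈ Finset.range j,
    if h : k + 1 < n then cq q (I ⟨k, Nat.lt_of_succ_lt h⟩) (I ⟨k + 1, h⟩) else 1

theorem KerovRuleVW.apply_eVW {n : ℕ} {q : ℝ} {k : ℕ} {hk : k + 1 < n} {R : HVW n →L[ℂ] HVW n}
    (h : KerovRuleVW n q k hk R) (I J : Fin n → Sz) :
    R (eVW I J) = (cq q (I ⟨k, Nat.lt_of_succ_lt hk⟩) (I ⟨k + 1, hk⟩) : ℂ) • eVW I J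
      + (if I ⟨k, Nat.lt_of_succ_lt hk⟩ = I ⟨k + 1, hk⟩ then 0 else -(Real.sqrt q : ℂ)) •
        eVW (swapAt I ⟨k, Nat.lt_of_succ_lt hk⟩ ⟨k + 1, hk⟩) J := by
  obtain ⟨h1, h2, h3⟩ := h I J
  rcases lt_trichotomy (I ⟨k, Nat.lt_of_succ_lt hk⟩ : ℤ) (I ⟨k + 1, hk⟩ : ℤ) with hlt | heq | hgt
  · have hne : I ⟨k, Nat.lt_of_succ_lt hk⟩ ≠ I ⟨k + 1, hk⟩ := fun h => hlt.ne (congrArg _ h)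
    rw [h3 hlt]
    simp only [cq, hlt.ne, hlt, hne, if_true, if_false]
    push_cast
    module
  · obtain ⟨h4, h5⟩ := h1 heq
    rw [if_pos (Subtype.ext heq), zero_smul, add_zero]
    rcases lt_or_gt_of_ne (I ⟨k, Nat.lt_of_succ_lt hk⟩).2 with hn | hp
    · rw [h4 hn]
      simp [cq, heq, heq ▸ hn]
    · rw [h5 hp]
      simp only [cq, heq, (heq ▸ hp : 0 < (I ⟨k + 1, hk⟩ : ℤ)).not_gt, if_true, if_false]
  · have hne : I ⟨k, Nat.lt_of_succ_lt hk⟩ ≠ I ⟨k + 1, hk⟩ := fun h => hgt.ne' (congrArg _ h)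
    rw [h2 hgt]
    simp only [cq, hgt.ne', hgt.not_gt, hne, if_false]
    push_cast
    module

theorem swapAt_apply_of_lt {n : ℕ} (K : Fin n → Sz) {k : ℕ} (hk : k + 1 < n) {p : Fin n}
    (hp : (p : ℕ) < k) :
    swapAt K ⟨k, Nat.lt_of_succ_lt hk⟩ ⟨k + 1, hk⟩ p = K p := by
  rw [swapAt, Function.update_of_ne (by rintro rfl; simp at hp),
    Function.update_of_ne (by rintro rfl; simp at hp)]

/-- The span of the basis vectors `e_{K,J}` with `K` and `I` differing in the first `j` places. -/
def differSpan {n : ℕ} (I J : Fin n → Sz) (j : ℕ) : Submodule ℂ (HVW n) :=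
  Submodule.span ℂ {v | ∃ K : Fin n → Sz, (∃ p : Fin n, (p : ℕ) < j ∧ K p ≠ I p) ∧ v = eVW K J}

theorem opChain_apply_eVW_sub_mem {n : ℕ} {q : ℝ} {Rl : ℕ → (HVW n →L[ℂ] HVW n)}
    (hR : ∀ k (hk : k + 1 < n), KerovRuleVW n q k hk (Rl k)) (I J : Fin n → Sz)
    (j : ℕ) (hj : j < n) :
    opChain Rl j (eVW I J) - (chainWeight q I j : ℂ) • eVW I J ∈ differSpan I J j := by
  induction j with
  | zero => simp [opChain, chainWeight]
  | succ k ih =>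
    have hmem : ∀ v ∈ differSpan I J k, Rl k v ∈ differSpan I J (k + 1) := by
      intro v hv
      induction hv using Submodule.span_induction with
      | mem v hv =>
        obtain ⟨K, ⟨p, hp, hKp⟩, rfl⟩ := hv
        rw [(hR k hj).apply_eVW]
        refine add_mem (Submodule.smul_mem _ _ (Submodule.subset_span ⟨K, ⟨p, by omega, hKp⟩, rfl⟩))
          (Submodule.smul_mem _ _ (Submodule.subset_span ⟨_, ⟨p, by omega, ?_⟩, rfl⟩))
        rwa [swapAt_apply_of_lt K hj hp]
      | zero => simp
      | add v w _ _ hv hw => rw [map_add]; exact add_mem hv hw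
      | smul c v _ hv => rw [map_smul]; exact Submodule.smul_mem _ _ hv
    have hdiag : Rl k (eVW I J)
        - (cq q (I ⟨k, Nat.lt_of_succ_lt hj⟩) (I ⟨k + 1, hj⟩) : ℂ) • eVW I J
          ∈ differSpan I J (k + 1) := by
      rw [(hR k hj).apply_eVW, add_sub_cancel_left]
      split_ifs with heq
      · simp
      · refine Submodule.smul_mem _ _ (Submodule.subset_span
          ⟨_, ⟨⟨k, Nat.lt_of_succ_lt hj⟩, Nat.lt_succ_self k, ?_⟩, rfl⟩)
        rw [swapAt, Function.update_of_ne (by simp), Function.update_self]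
        exact Ne.symm heq
    have hsplit := add_mem (hmem _ (ih (by omega)))
      (Submodule.smul_mem _ (chainWeight q I k : ℂ) hdiag)
    convert hsplit using 1
    rw [map_sub, map_smul, chainWeight, Finset.prod_range_succ, dif_pos hj, ← chainWeight]
    simp only [opChain, mul_apply_eq_comp]
    push_cast
    module

theorem inner_eVW_right {n : ℕ} (v : HVW n) (K J : Fin n → Sz) :
    inner ℂ v (eVW K J) = starRingEnd ℂ (v (K, J)) := by
  simp [eVW, lp.inner_single_right]

theorem hasSum_Xi {n : ℕ} {a : Sz → ℝ} (ha : ∀ i, 0 ≤ a i)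
    (hs : Summable fun I : Fin n → Sz => ∏ k, a (I k)) :
    HasSum (fun I : Fin n → Sz => (Real.sqrt (∏ k, a (I k)) : ℂ) • eVW I I) (Xi n a) := by
  have horth : OrthogonalFamily ℂ (fun _ : Fin n → Sz => ℂ)
      (fun I => LinearIsometry.toSpanSingleton ℂ (HVW n)
        (show ‖eVW I I‖ = 1 by simp [eVW, lp.norm_single])) := by
    intro I J hIJ x y
    simp only [LinearIsometry.toSpanSingleton_apply, inner_smul_left, inner_smul_right,
      inner_eVW_right]
    simp [eVW, lp.single_apply, hIJ]
  have := (horth.summable_iff_norm_sq_summable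
    (fun I => (Real.sqrt (∏ k, a (I k)) : ℂ))).2 (by
      convert hs using 2 with I
      rw [Complex.norm_real, Real.norm_eq_abs, sq_abs,
        Real.sq_sqrt (Finset.prod_nonneg fun k _ => ha _)])
  simpa [Xi, LinearIsometry.toSpanSingleton_apply] using this.hasSum

theorem Xi_apply {n : ℕ} {a : Sz → ℝ} (ha : ∀ i, 0 ≤ a i)
    (hs : Summable fun I : Fin n → Sz => ∏ k, a (I k)) (K J : Fin n → Sz) :
    Xi n a (K, J) = if K = J then (Real.sqrt (∏ k, a (J k)) : ℂ) else 0 := by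
  have h := ((hasSum_Xi ha hs).mapL (innerSL ℂ (eVW K J))).tsum_eq
  have hc : ∀ v : HVW n, inner ℂ (eVW K J) v = v (K, J) := fun v => by
    simp [eVW, lp.inner_single_left]
  simp only [innerSL_apply_apply, hc, lp.coeFn_smul, Pi.smul_apply] at h
  rw [← h, tsum_eq_single J]
  · by_cases hKJ : K = J <;> simp [eVW, lp.single_apply, hKJ]
  · intro I hI
    have hne : (K, J) ≠ (I, I) := fun h => hI (congrArg Prod.snd h).symm
    simp [eVW, lp.single_apply, hne]

theorem hasSum_inner_opChain {n : ℕ} {q : ℝ} {a : Sz → ℝ} (ha : ∀ i, 0 ≤ a i)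
    (hs : Summable fun I : Fin n → Sz => ∏ k, a (I k)) {Rl : ℕ → (HVW n →L[ℂ] HVW n)}
    (hR : ∀ k (hk : k + 1 < n), KerovRuleVW n q k hk (Rl k)) (j : ℕ) (hj : j < n) :
    HasSum (fun I : Fin n → Sz => (((∏ k, a (I k)) * chainWeight q I j : ℝ) : ℂ))
      (inner ℂ (Xi n a) (opChain Rl j (Xi n a))) := by
  have h := (hasSum_Xi ha hs).mapL (innerSL ℂ (Xi n a) ∘L opChain Rl j)
  have hterm : ∀ I : Fin n → Sz, (((∏ k, a (I k)) * chainWeight q I j : ℝ) : ℂ)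
      = (innerSL ℂ (Xi n a) ∘L opChain Rl j) ((Real.sqrt (∏ k, a (I k)) : ℂ) • eVW I I) := by
    intro I
    have hzero : ∀ v ∈ differSpan I I j, inner ℂ (Xi n a) v = 0 := by
      intro v hv
      induction hv using Submodule.span_induction with
      | mem v hv =>
        obtain ⟨K, ⟨p, -, hKp⟩, rfl⟩ := hv
        rw [inner_eVW_right, Xi_apply ha hs, if_neg (fun h => hKp (congrFun h p)), map_zero]
      | zero => simp
      | add v w _ _ hv hw => rw [inner_add_right, hv, hw, add_zero]
      | smul c v _ hv => rw [inner_smul_right, hv, mul_zero]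
    have hI := hzero _ (opChain_apply_eVW_sub_mem hR I I j hj)
    rw [inner_sub_right, sub_eq_zero, inner_smul_right, inner_eVW_right, Xi_apply ha hs,
      if_pos rfl, Complex.conj_ofReal] at hI
    simp only [ContinuousLinearMap.comp_apply, map_smul, innerSL_apply_apply, hI, smul_eq_mul]
    rw [mul_left_comm, ← Complex.ofReal_mul, Real.mul_self_sqrt (Finset.prod_nonneg fun k _ => ha _)]
    push_cast
    ring
  rw [funext hterm]
  exact h

theorem sum_piFinset_snoc {n : ℕ} (T : Finset Sz) (F : (Fin (n + 1) → Sz) → ℝ) :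
    ∑ I ∈ Fintype.piFinset (fun _ : Fin (n + 1) => T), F I
      = ∑ I ∈ Fintype.piFinset (fun _ : Fin n => T), ∑ x ∈ T,
          F (Fin.snoc (α := fun _ => Sz) I x) := by
  rw [← Finset.sum_product']
  symm
  refine Finset.sum_nbij' (fun p => Fin.snoc (α := fun _ => Sz) p.1 p.2)
    (fun I => (Fin.init I, I (Fin.last n))) ?_ ?_ ?_ ?_ ?_
  · rintro ⟨I, x⟩ h
    simp only [Finset.mem_product, Fintype.mem_piFinset] at h ⊢
    intro i
    refine Fin.lastCases ?_ (fun i => ?_) i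
    · simpa using h.2
    · simpa using h.1 i
  · intro I h
    simp only [Finset.mem_product, Fintype.mem_piFinset] at h ⊢
    exact ⟨fun i => h _, h _⟩
  · rintro ⟨I, x⟩ -
    simp
  · intro I _
    simp
  · intro _ _
    rfl

theorem prod_snoc {n : ℕ} (a : Sz → ℝ) (I : Fin n → Sz) (x : Sz) :
    ∏ k, a (Fin.snoc (α := fun _ => Sz) I x k) = (∏ k, a (I k)) * a x := by
  simp [Fin.prod_univ_castSucc]

theorem chainWeight_snoc {n : ℕ} (q : ℝ) (I : Fin n → Sz) (x : Sz) {j : ℕ} (hj : j < n) :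
    chainWeight q (Fin.snoc (α := fun _ => Sz) I x) j = chainWeight q I j := by
  refine Finset.prod_congr rfl fun k hk => ?_
  have hk := Finset.mem_range.1 hk
  have h1 : k + 1 < n := by omega
  have h2 : k < n := by omega
  rw [dif_pos (by omega), dif_pos h1]
  simp [Fin.snoc, h1, h2]

theorem chainWeight_snoc_last {n : ℕ} (q : ℝ) (I : Fin (n + 1) → Sz) (x : Sz) :
    chainWeight q (Fin.snoc (α := fun _ => Sz) I x) (n + 1)
      = chainWeight q I n * cq q (I (Fin.last n)) x := by
  rw [chainWeight, Finset.prod_range_succ, ← chainWeight, chainWeight_snoc q I x n.lt_succ_self,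
    dif_pos (by omega)]
  simp [Fin.snoc, Fin.last]

theorem sum_words_mul_lastLetter (q : ℝ) (a : Sz → ℝ) (T : Finset Sz) (m : ℕ) (φ : Sz → ℝ) :
    ∑ I ∈ Fintype.piFinset (fun _ : Fin (m + 1) => T),
        (∏ k, a (I k)) * chainWeight q I m * φ (I (Fin.last m))
      = ∑ y ∈ T, lastLetterWeight q a T m y * φ y := by
  induction m generalizing φ with
  | zero =>
    rw [sum_piFinset_snoc]
    simp [chainWeight, lastLetterWeight, Fin.snoc]
  | succ m ih =>
    rw [sum_piFinset_snoc]
    have h := ih (fun y => ∑ x ∈ T, cq q y x * (a x * φ x))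
    simp only [Finset.mul_sum] at h
    simp only [prod_snoc, chainWeight_snoc_last, Fin.snoc_last, lastLetterWeight]
    calc _ = _ := Finset.sum_congr rfl fun I _ => Finset.sum_congr rfl fun x _ => by ring
      _ = _ := h
      _ = _ := Finset.sum_comm
      _ = _ := Finset.sum_congr rfl fun x _ => by
        rw [Finset.mul_sum, Finset.sum_mul]
        exact Finset.sum_congr rfl fun y _ => by ring

theorem sum_words (q : ℝ) (a : Sz → ℝ) (T : Finset Sz) (m r : ℕ) :
    ∑ I ∈ Fintype.piFinset (fun _ : Fin (m + 1 + r) => T), (∏ k, a (I k)) * chainWeight q I m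
      = (∑ x ∈ T, a x) ^ r * ∑ y ∈ T, lastLetterWeight q a T m y := by
  induction r with
  | zero => simpa using sum_words_mul_lastLetter q a T m (fun _ => 1)
  | succ r ih =>
    rw [pow_succ, mul_right_comm, ← ih, Finset.sum_mul]
    refine (sum_piFinset_snoc (n := m + 1 + r) T _).trans (Finset.sum_congr rfl fun I _ => ?_)
    rw [Finset.mul_sum]
    refine Finset.sum_congr rfl fun x _ => ?_
    exact (congrArg₂ (· * ·) (prod_snoc a I x) (chainWeight_snoc q I x (by omega))).trans
      (mul_right_comm _ _ _)

theorem tendsto_piFinset_atTop {ι X : Type*} [Fintype ι] [DecidableEq ι] [DecidableEq X] :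
    Filter.Tendsto (fun T : Finset X => Fintype.piFinset (fun _ : ι => T))
      Filter.atTop Filter.atTop := by
  refine Filter.tendsto_atTop_atTop.2 fun u =>
    ⟨u.biUnion fun I => Finset.univ.image I, fun T hT I hI => Fintype.mem_piFinset.2 fun i => hT ?_⟩
  exact Finset.mem_biUnion.2 ⟨I, hI, Finset.mem_image_of_mem I (Finset.mem_univ i)⟩

theorem summable_prod_apply {ι X : Type*} [Fintype ι] {a : X → ℝ} (ha : ∀ i, 0 ≤ a i)
    (hs : Summable a) : Summable fun I : ι → X => ∏ k, a (I k) := by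
  classical
  refine summable_of_sum_le (c := (∑' x, a x) ^ Fintype.card ι)
    (fun I => Finset.prod_nonneg fun k _ => ha _) fun u => ?_
  obtain ⟨T, hT⟩ := (tendsto_piFinset_atTop.eventually_ge_atTop u).exists
  calc ∑ I ∈ u, ∏ k, a (I k)
      ≤ ∑ I ∈ Fintype.piFinset (fun _ : ι => T), ∏ k, a (I k) :=
        Finset.sum_le_sum_of_subset_of_nonneg hT fun I _ _ => Finset.prod_nonneg fun k _ => ha _
    _ = (∑ x ∈ T, a x) ^ Fintype.card ι := by
        rw [← Finset.prod_univ_sum, Finset.prod_const, Finset.card_univ]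
    _ ≤ _ := pow_le_pow_left₀ (Finset.sum_nonneg fun x _ => ha x)
        (hs.sum_le_tsum T fun x _ => ha x) _

theorem Summable.pow_succ_of_nonneg {X : Type*} {f : X → ℝ} (hf : Summable f)
    (h0 : ∀ x, 0 ≤ f x) (j : ℕ) : Summable fun x => f x ^ (j + 1) := by
  refine Summable.of_nonneg_of_le (fun x => pow_nonneg (h0 x) _) (fun x => ?_)
    (hf.mul_left ((∑' x, f x) ^ j))
  rw [pow_succ]
  exact mul_le_mul_of_nonneg_right
    (pow_le_pow_left₀ (h0 x) (hf.le_tsum x fun y _ => h0 y) j) (h0 x)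

/-- The nonzero integers as two copies of `ℕ`, the positive and the negative ones. -/
def sumEquivSz : ℕ ⊕ ℕ ≃ Sz where
  toFun := Sum.elim (fun j => ⟨j + 1, by omega⟩) (fun i => ⟨-(i + 1), by omega⟩)
  invFun x := if 0 < (x : ℤ) then Sum.inl ((x : ℤ).toNat - 1) else Sum.inr ((-(x : ℤ)).toNat - 1)
  left_inv := by
    rintro (j | i)
    · have h : (0 : ℤ) < j + 1 := by omega
      simp [h]
    · have h : ¬ (0 : ℤ) < -(i + 1) := by omega
      simp only [Sum.elim_inr, h, if_false, neg_neg]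
      congr 1
  right_inv := by
    rintro ⟨x, hx⟩
    dsimp only
    split_ifs with h <;> apply Subtype.ext <;> simp only [Sum.elim_inl, Sum.elim_inr] <;> omega

theorem hasSum_superTerm {α β : ℕ → ℝ} (hα : ∀ j, 0 ≤ α j) (hβ : ∀ i, 0 ≤ β i)
    (hαs : Summable α) (hβs : Summable β) (j : ℕ) :
    HasSum (superTerm (aOf α β) j) (superNewton α β (j + 1)) := by
  rw [← sumEquivSz.hasSum_iff]
  refine HasSum.sum ?_ ?_
  · convert (hαs.pow_succ_of_nonneg hα j).hasSum using 1
    funext k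
    have h : (0 : ℤ) < k + 1 := by omega
    simp [sumEquivSz, superTerm, aOf, h]
  · have hterm : superTerm (aOf α β) j ∘ sumEquivSz ∘ Sum.inr
        = fun i => (-1) ^ j * β i ^ (j + 1) := by
      funext k
      have h : ¬ (0 : ℤ) < -(k + 1) := by omega
      have hk : ((k : ℤ) + 1).toNat - 1 = k := by omega
      simp only [sumEquivSz, superTerm, aOf, Function.comp_apply, Equiv.coe_fn_mk, Sum.elim_inr, h,
        if_false, neg_neg, hk]
    rw [Function.comp_assoc, hterm]
    exact (hβs.pow_succ_of_nonneg hβ j).hasSum.mul_left ((-1) ^ j)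

theorem sum_lastLetterWeight {q : ℝ} (hq1 : q ≠ 1) (a : Sz → ℝ) (T : Finset Sz) (m : ℕ) :
    ∑ y ∈ T, lastLetterWeight q a T m y
      = (q - 1)⁻¹ * ∑ μ ∈ multiplicities (m + 1),
          cycleTerm (fun j => (q ^ (j + 1) - 1) * ∑ x ∈ T, superTerm a j x) μ := by
  rw [← coeff_eq_sum_cycleTerm (E := wordSeries q a T) (by simp [wordSeries])
    (derivative_wordSeries q a T), wordSeries, map_add, mul_assoc, PowerSeries.coeff_C_mul,
    PowerSeries.coeff_succ_X_mul, map_sum, PowerSeries.coeff_one, if_neg (Nat.succ_ne_zero m),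
    zero_add, inv_mul_cancel_left₀ (sub_ne_zero.2 hq1)]
  simp

theorem tendsto_cycleTerm {X : Type*} {l : Filter X} {t : X → ℕ → ℝ} {s : ℕ → ℝ}
    (h : ∀ j, Filter.Tendsto (fun x => t x j) l (nhds (s j))) (μ : ℕ →₀ ℕ) :
    Filter.Tendsto (fun x => cycleTerm (t x) μ) l (nhds (cycleTerm s μ)) :=
  tendsto_finsetProd _ fun j _ => ((h j).pow _).div_const _

theorem zeta_matrix_element_eq_Vershik_Kerov_trace (n : ℕ) (q : ℝ) (hq : 0 < q) (hq1 : q ≠ 1)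
    (α β : ℕ → ℝ) (hα : ∀ j, 0 ≤ α j) (hβ : ∀ i, 0 ≤ β i)
    (hαs : Summable α) (hβs : Summable β)
    (hab : ∑' j, α j + ∑' i, β i = 1)
    (Rl : ℕ → (HVW n →L[ℂ] HVW n))
    (hR : ∀ k (hk : k + 1 < n), KerovRuleVW n q k hk (Rl k))
    (m : ℕ) (hm : 1 ≤ m) (hmn : m ≤ n) :
    (inner ℂ (Xi n (aOf α β)) (opChain Rl (m - 1) (Xi n (aOf α β))) : ℂ)
      = (((q - 1)⁻¹ *
          ∑' μ : {μ : ℕ →₀ ℕ // μ.sum (fun j t => (j + 1) * t) = m},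
            (μ.1.prod fun j t => (q ^ (j + 1) - 1) ^ t / ((j + 1 : ℝ) ^ t * (Nat.factorial t)))
              * ∏ j ∈ μ.1.support,
                  (if j = 0 then (1 : ℝ) else superNewton α β (j + 1) ^ (μ.1 j)) : ℝ) : ℂ) := by
  have hone : superNewton α β 1 = 1 := by simpa [superNewton] using hab
  have ha : ∀ i, 0 ≤ aOf α β i := fun i => by
    unfold aOf
    split_ifs
    exacts [hα _, hβ _]
  have has : HasSum (aOf α β) 1 := by
    rw [← hone]
    have hterm : superTerm (aOf α β) 0 = aOf α β := by
      funext x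
      simp [superTerm]
    exact hterm ▸ hasSum_superTerm hα hβ hαs hβs 0
  obtain ⟨m, rfl⟩ : ∃ k, m = k + 1 := ⟨m - 1, by omega⟩
  obtain ⟨r, rfl⟩ : ∃ r, n = m + 1 + r := ⟨n - (m + 1), by omega⟩
  have hL := (hasSum_inner_opChain ha (summable_prod_apply ha has.summable) hR m
    (by omega)).comp tendsto_piFinset_atTop
  have hterms : ∀ j, Filter.Tendsto
      (fun T : Finset Sz => (q ^ (j + 1) - 1) * ∑ x ∈ T, superTerm (aOf α β) j x)
      Filter.atTop (nhds ((q ^ (j + 1) - 1) * superNewton α β (j + 1))) := fun j =>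
    Filter.Tendsto.const_mul _ (hasSum_superTerm hα hβ hαs hβs j)
  have hR' := (Filter.Tendsto.pow has r).mul ((tendsto_finsetSum (multiplicities (m + 1))
    fun μ _ => tendsto_cycleTerm hterms μ).const_mul (q - 1)⁻¹)
  simp only [← sum_lastLetterWeight hq1, ← sum_words, one_pow, one_mul] at hR'
  have hlim := tendsto_nhds_unique hL
    (((Complex.continuous_ofReal.tendsto _).comp hR').congr fun T => by simp)
  rw [Nat.add_sub_cancel, hlim]
  congr 2
  have hsub := Finset.tsum_subtype (multiplicities (m + 1))
    (cycleTerm fun j => (q ^ (j + 1) - 1) * superNewton α β (j + 1))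
  rw [← hsub]
  refine Eq.trans (tsum_congr fun μ => ?_)
    ((Equiv.subtypeEquivRight fun μ => mem_multiplicities).tsum_eq _)
  rw [Equiv.subtypeEquivRight_apply_coe, cycleTerm, Finsupp.prod, Finsupp.prod,
    ← Finset.prod_mul_distrib]
  refine Finset.prod_congr rfl fun j _ => ?_
  split_ifs with hj
  · simp [hj, hone]
  · rw [mul_pow]
    ring
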